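/- Let Q be a commutative A-loop such that y^2 P_x = x^2 P_y for all x, y (where P_x = L_x L_{x^{-1}}^{-1} and y^2 P_x means applying P_x to y^2). Then y^2 P_x = x^2 y^2 for all x, y. -/

import Mathlib

/-- A commutative loop: commutative binary operation with two-sided identity
and a left division making all translations bijective. -/
class CommLoop (Q : Type*) extends Mul Q, One Q where
  mul_comm : ∀ x y : Q, x * y = y * x
  one_mul : ∀ x : Q, 1 * x = x
  mul_one : ∀ x : Q, x * 1 = x
  ldiv : Q → Q → Q
  mul_ldiv : ∀ x y : Q, x * ldiv x y = y
  ldiv_mul : ∀ x y : Q, ldiv x (x * y) = y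

namespace CommLoop

variable {Q : Type*} [CommLoop Q]

/-- The inverse `x⁻¹ = x \ 1`. -/
def inv (x : Q) : Q := ldiv x 1

/-- The inner mapping `L_{x,y} = L_x L_y L_{yx}⁻¹` (permutations acting on the right):
`z L_{x,y} = (yx) \ (y(xz))`. -/
def inn (x y z : Q) : Q := ldiv (y * x) (y * (x * z))

/-- Natural powers: `x^n = 1 L_x^n`. -/
def npow (x : Q) (n : ℕ) : Q := (fun y => x * y)^[n] 1

/-- Integer powers: `x^n = 1 L_x^n`. -/
def zpow (x : Q) : ℤ → Q
  | Int.ofNat n => npow x n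
  | Int.negSucc n => (fun y => ldiv x y)^[n + 1] 1

/-- A commutative A-loop: every inner mapping `L_{x,y}` is an automorphism. -/
class IsALoop (Q : Type*) [CommLoop Q] : Prop where
  inn_mul : ∀ x y u v : Q, inn x y (u * v) = inn x y u * inn x y v

/-- The left translation `L_x` as a permutation of `Q`. -/
def Le (x : Q) : Equiv.Perm Q :=
  ⟨fun y => x * y, fun y => ldiv x y, fun y => ldiv_mul x y, fun y => mul_ldiv x y⟩

/-- The permutation `P_x = L_x L_{x⁻¹}⁻¹`. -/
def Pe (x : Q) : Equiv.Perm Q := (Le x).trans (Le (inv x)).symm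

end CommLoop

namespace CommLoop

variable {Q : Type*} [CommLoop Q]

theorem mul_left_cancel {x y z : Q} (h : x * y = x * z) : y = z := by
  rw [← ldiv_mul x y, h, ldiv_mul]

theorem mul_inv (x : Q) : x * inv x = 1 := mul_ldiv x 1

theorem inv_mul (x : Q) : inv x * x = 1 := by rw [CommLoop.mul_comm, mul_inv]

theorem eq_inv_of_mul_eq_one {x y : Q} (h : x * y = 1) : y = inv x :=
  mul_left_cancel (h.trans (mul_inv x).symm)

theorem inv_inv (x : Q) : inv (inv x) = x := (eq_inv_of_mul_eq_one (inv_mul x)).symm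

theorem Le_one : Le (1 : Q) = 1 := Equiv.ext CommLoop.one_mul

theorem Pe_eq (x : Q) : Pe x = (Le (inv x))⁻¹ * Le x := rfl

/-- The inner mapping `L_{y,x}`, as a permutation. -/
def innPerm (x y : Q) : Equiv.Perm Q := (Le (x * y))⁻¹ * (Le x * Le y)

theorem mul_innPerm (x y z : Q) : x * y * innPerm x y z = x * (y * z) := mul_ldiv _ _

theorem Le_mul_innPerm (x y : Q) : Le (x * y) * innPerm x y = Le x * Le y := by
  rw [innPerm, mul_inv_cancel_left]

theorem innPerm_self (x y : Q) : innPerm x y x = x :=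
  mul_left_cancel (x := x * y) (by
    rw [mul_innPerm, CommLoop.mul_comm y x, CommLoop.mul_comm (x * y) x])

theorem Pe_inv (x : Q) : Pe (inv x) = (Pe x)⁻¹ := by
  rw [Pe_eq, Pe_eq, inv_inv, mul_inv_rev, _root_.inv_inv]

variable [IsALoop Q]

theorem innPerm_mul (x y u v : Q) :
    innPerm x y (u * v) = innPerm x y u * innPerm x y v :=
  IsALoop.inn_mul y x u v

theorem innPerm_one (x y : Q) : innPerm x y 1 = 1 :=
  mul_left_cancel (x := innPerm x y 1) (by
    rw [← innPerm_mul, CommLoop.mul_one, CommLoop.mul_one])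

theorem innPerm_inv (x y u : Q) : innPerm x y (inv u) = inv (innPerm x y u) :=
  eq_inv_of_mul_eq_one (by rw [← innPerm_mul, mul_inv, innPerm_one])

theorem innPerm_mul_Le (x y u : Q) :
    innPerm x y * Le u = Le (innPerm x y u) * innPerm x y :=
  Equiv.ext fun v => innPerm_mul x y u v

theorem Le_innPerm (x y u : Q) :
    Le (innPerm x y u) = innPerm x y * Le u * (innPerm x y)⁻¹ :=
  eq_mul_inv_of_mul_eq (innPerm_mul_Le x y u).symm

theorem Pe_innPerm (x y u : Q) :
    Pe (innPerm x y u) = innPerm x y * Pe u * (innPerm x y)⁻¹ := by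
  rw [Pe_eq, Pe_eq, ← innPerm_inv, Le_innPerm, Le_innPerm]
  group

theorem commute_innPerm_Pe (x y : Q) : Commute (innPerm x y) (Pe x) := by
  have h := Pe_innPerm x y x
  rw [innPerm_self] at h
  exact (eq_mul_inv_iff_mul_eq.mp h).symm

theorem commute_Le_inv (x : Q) : Commute (Le x) (Le (inv x)) := by
  have h := innPerm_mul_Le x (inv x) x
  rw [innPerm_self, innPerm, mul_inv, Le_one, inv_one, _root_.one_mul, mul_assoc] at h
  exact (_root_.mul_left_cancel h).symm

theorem commute_Le_Pe (x : Q) : Commute (Le x) (Pe x) :=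
  (commute_Le_inv x).inv_right.mul_right (Commute.refl _)

theorem Pe_apply_one (x : Q) : Pe x 1 = x * x :=
  mul_left_cancel (x := inv x) (by
    have h : x * (inv x * x) = inv x * (x * x) := Equiv.congr_fun (commute_Le_inv x).eq x
    rw [← h, inv_mul]
    exact mul_ldiv _ _)

/-- The automorphic inverse property. -/
theorem inv_mul_eq (x y : Q) : inv (x * y) = inv x * inv y := by
  suffices H : ∀ y z : Q, y * inv z = inv (inv y * z) by
    rw [H (inv x) y, inv_inv]
  intro y z
  have hz : innPerm (inv y * z) y z = y * (inv y * z) := by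
    refine mul_left_cancel (x := innPerm (inv y * z) y (inv y)) ?_
    rw [← innPerm_mul, innPerm_self, CommLoop.mul_comm (innPerm _ _ _),
      CommLoop.mul_comm y (inv y * z), mul_innPerm, mul_inv, CommLoop.mul_one]
  exact eq_inv_of_mul_eq_one (by
    rw [← mul_innPerm, innPerm_inv, hz, CommLoop.mul_comm y, mul_inv])

/-- Inversion, as a permutation. -/
def invPerm (Q : Type*) [CommLoop Q] : Equiv.Perm Q := ⟨inv, inv, inv_inv, inv_inv⟩

theorem Le_inv (x : Q) : Le (inv x) = invPerm Q * Le x * (invPerm Q)⁻¹ :=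
  eq_mul_inv_of_mul_eq (Equiv.ext fun y => (inv_mul_eq x y).symm)

theorem commute_invPerm_innPerm (x y : Q) : Commute (invPerm Q) (innPerm x y) :=
  Equiv.ext fun u => (innPerm_inv x y u).symm

theorem innPerm_inv_inv (x y : Q) : innPerm (inv x) (inv y) = innPerm x y := by
  rw [← mul_inv_eq_of_eq_mul (commute_invPerm_innPerm x y).eq, innPerm, innPerm, ← inv_mul_eq,
    Le_inv, Le_inv, Le_inv]
  group

theorem Pe_eq_mul_inv (x : Q) : Pe x = Le x * (Le (inv x))⁻¹ :=
  (commute_Le_inv x).inv_right.eq.symm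

theorem Pe_mul (x y : Q) : Pe (x * y) = Le x * (Pe y * Pe x) * (Le x)⁻¹ := by
  have h := Le_mul_innPerm (inv x) (inv y)
  rw [innPerm_inv_inv, ← inv_mul_eq] at h
  rw [Pe_eq_mul_inv (x * y), eq_mul_inv_of_mul_eq h, eq_mul_inv_of_mul_eq (Le_mul_innPerm x y),
    Pe_eq_mul_inv y, Pe_eq x]
  group

theorem Pe_mul_apply_inv (x y : Q) : Pe (x * y) (inv x) = x * (y * y) := by
  have hc : x * y * inv (innPerm x y y) = x := by
    rw [← innPerm_inv, mul_innPerm, mul_inv, CommLoop.mul_one]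
  have hc' : inv (x * y) * innPerm x y y = inv x := by
    rw [← congrArg inv hc, inv_mul_eq (x * y), inv_inv]
  have h : x * y * (inv (x * y) * innPerm x y y) = inv (x * y) * (x * y * innPerm x y y) :=
    Equiv.congr_fun (commute_Le_inv (x * y)).eq _
  rw [hc', mul_innPerm] at h
  exact mul_left_cancel (x := inv (x * y)) ((mul_ldiv _ _).trans h)

theorem Pe_mul_self (x : Q) : Pe (x * x) = Pe x * Pe x := by
  rw [Pe_mul, ((commute_Le_Pe x).mul_right (commute_Le_Pe x)).eq, mul_inv_cancel_right]

theorem Pe_mul_mul_self (x y : Q) :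
    Pe (x * (y * y)) = Pe (x * y) * (Pe x)⁻¹ * Pe (x * y) := by
  have h := (commute_Le_Pe x).inv_inv.eq
  calc Pe (x * (y * y))
      = Le x * Pe y * Pe x * ((Pe x)⁻¹ * (Le x)⁻¹) * Le x * Pe y * Pe x * (Le x)⁻¹ := by
        rw [Pe_mul, Pe_mul_self]; group
    _ = Pe (x * y) * (Pe x)⁻¹ * Pe (x * y) := by
        rw [← h, Pe_mul]; group

theorem inv_innPerm_conj_Pe_mul (x y : Q) :
    (innPerm x y)⁻¹ * Pe (x * y) * innPerm x y = Pe y * (Le y)⁻¹ * Pe x * Le y := by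
  have h := Le_mul_innPerm (inv x) (inv y)
  rw [innPerm_inv_inv, ← inv_mul_eq] at h
  rw [Pe_eq (x * y), eq_mul_inv_of_mul_eq h, eq_mul_inv_of_mul_eq (Le_mul_innPerm x y),
    Pe_eq y, Pe_eq x]
  group

theorem inv_innPerm_conj_Pe_mul_mul_self (x y : Q) :
    (innPerm x y)⁻¹ * Pe (x * (y * y)) * innPerm x y = Pe y * Pe x * Pe y := by
  have h := (commute_Le_Pe y).eq
  calc (innPerm x y)⁻¹ * Pe (x * (y * y)) * innPerm x y
      = Le y * ((innPerm x y)⁻¹ * Pe (x * y) * innPerm x y) * (Pe y * (Le y)⁻¹) := by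
        rw [← mul_innPerm, CommLoop.mul_comm (x * y), Pe_mul, Le_innPerm, Pe_innPerm]
        group
    _ = (Le y * Pe y) * (Le y)⁻¹ * Pe x * (Le y * Pe y) * (Le y)⁻¹ := by
        rw [inv_innPerm_conj_Pe_mul]
        group
    _ = Pe y * Pe x * Pe y := by
        rw [h]
        group

theorem Pe_mul_eq (x y : Q) :
    Pe (x * y) = Pe y * Pe x * (Pe (x * y))⁻¹ * Pe x * Pe y := by
  have h₁ : (innPerm (x * y) x)⁻¹ * Pe (x * y * x) * innPerm (x * y) x =
      Pe x * Pe y * Pe x := by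
    rw [inv_innPerm_conj_Pe_mul, Pe_mul]
    group
  have h₂ : Pe x * Pe y * Pe x * (Pe (x * y))⁻¹ * (Pe x * Pe y * Pe x) =
      Pe x * Pe (x * y) * Pe x := by
    rw [← inv_innPerm_conj_Pe_mul_mul_self (x * y) x, Pe_mul_mul_self, ← h₁]
    simp only [mul_assoc]
    rw [← mul_assoc (Pe (x * y))⁻¹ (innPerm (x * y) x)⁻¹,
      ← (commute_innPerm_Pe (x * y) x).inv_inv.eq]
    group
  refine _root_.mul_left_cancel (a := Pe x) (_root_.mul_right_cancel (b := Pe x) ?_)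
  rw [← h₂]
  group

end CommLoop

open CommLoop in
/-- If `y² P_x = x² P_y` holds for all `x, y`, then `y² P_x = x² y²` for all `x, y`. -/
theorem stmt12 {Q : Type*} [CommLoop Q] [IsALoop Q]
    (h : ∀ x y : Q, Pe x (y * y) = Pe y (x * x)) :
    ∀ x y : Q, Pe x (y * y) = (x * x) * (y * y) := by
  intro x y
  have h₁ : (x * x) * (y * y) = Pe (y * (x * x)) (inv (x * x)) := by
    rw [CommLoop.mul_comm y (x * x), Pe_mul_apply_inv]
  have h₂ : Pe (x * y) ((Pe x)⁻¹ 1) = (Pe x)⁻¹ (Pe (x * y) 1) := by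
    rw [← Pe_inv, Pe_apply_one, Pe_apply_one, h]
  have h₃ : inv (x * x) = (Pe x)⁻¹ 1 := by
    rw [← Pe_inv, Pe_apply_one, inv_mul_eq]
  have h₄ : Pe (x * y) * (Pe y)⁻¹ * (Pe x)⁻¹ * Pe (x * y) = Pe y * Pe x := by
    nth_rewrite 1 [Pe_mul_eq x y]
    group
  rw [h₁, Pe_mul_mul_self, h₃, Equiv.Perm.mul_apply, CommLoop.mul_comm y x, h₂,
    ← Equiv.Perm.mul_apply, ← Equiv.Perm.mul_apply, h₄, Equiv.Perm.mul_apply, Pe_apply_one, h]
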